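/- For every finite linearly ordered set A and every A-cubical complex K, the discrete vector field W_K is a gradient field on the poset P_K. -/

import Mathlib

section Core

variable {A : Type*} [DecidableEq A] [Fintype A]

/-- A cube of the standard `A`-cube: `none` means `*`, `some true` means `1`,
`some false` means `0`. -/
abbrev Cube (A : Type*) := A → Option Bool

/-- The cube `c(O, S, rest)` with value `1` on `O`, `*` on `S` and `0` elsewhere. -/
def cubeOn (O S : Finset A) : Cube A := fun a =>
  if a ∈ S then none else if a ∈ O then some true else some false

/-- An `A`-cubical complex: a set of cubes closed under the face maps, i.e. under
replacing any occurrence of `*` by `0` or `1`. -/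
def IsComplex (K : Set (Cube A)) : Prop :=
  ∀ c ∈ K, ∀ a : A, c a = none → ∀ ε : Bool, Function.update c a (some ε) ∈ K

/-- Union of the blocks of a list of finsets. -/
def blocksUnion (L : List (Finset A)) : Finset A := L.foldr (· ∪ ·) ∅

/-- `L` is an ordered partition of `S`: a sequence of nonempty pairwise disjoint
subsets whose union is `S`. -/
def IsOPart (S : Finset A) (L : List (Finset A)) : Prop :=
  (∀ B ∈ L, B.Nonempty) ∧
    List.Pairwise (fun B C : Finset A => Disjoint B C) L ∧ blocksUnion L = S

/-- The set `P_K` of ordered partitions `L = B₁|…|B_l` of `S` such that each cube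
`c((O ∪ B₁∪…∪B_{i-1}), B_i, rest)` belongs to `K`.  Here `O` records the part of the
ambient set on which the cubes take the fixed value `1` (used for the restrictions
`K|_B^ε`); for the full complex take `O = ∅`, `S = univ`. -/
def PK (K : Set (Cube A)) (O S : Finset A) : Set (List (Finset A)) :=
  {L | IsOPart S L ∧ ∀ (i : ℕ) (h : i < L.length),
    cubeOn (O ∪ blocksUnion (L.take i)) (L[i]'h) ∈ K}

/-- `x` refines `y`: the blocks of `y` are obtained by uniting consecutive blocks of `x`. -/
def Refines (x y : List (Finset A)) : Prop :=
  ∃ LL : List (List (Finset A)), (∀ l ∈ LL, l ≠ []) ∧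
    x = LL.flatten ∧ y = LL.map blocksUnion

/-- Dimension of an ordered partition: `Σ (#Bᵢ - 1)`. -/
def pdim (L : List (Finset A)) : ℕ := (L.map fun B => B.card - 1).sum

/-- The facet relation on ordered partitions. -/
def PFacet (x y : List (Finset A)) : Prop :=
  Refines x y ∧ x ≠ y ∧ pdim y = pdim x + 1

/-- A cycle of a discrete vector field on a poset of ordered partitions. -/
def PCycle (V : Set (List (Finset A) × List (Finset A))) (k : ℕ)
    (a : Fin (k + 1) → List (Finset A)) (b : Fin k → List (Finset A)) : Prop :=
  0 < k ∧ a 0 = a (Fin.last k) ∧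
    ∀ i : Fin k, (a i.castSucc, b i) ∈ V ∧ (a i.succ, b i) ∉ V ∧ PFacet (a i.succ) (b i)

/-- A discrete vector field on ordered partitions is a gradient field if it has no cycle. -/
def PGradient (V : Set (List (Finset A) × List (Finset A))) : Prop :=
  ∀ k a b, ¬ PCycle V k a b

/-- Critical cells of a discrete vector field `V` on the set of cells `S`. -/
def CritOn (S : Set (List (Finset A)))
    (V : Set (List (Finset A) × List (Finset A))) : Set (List (Finset A)) :=
  {x | x ∈ S ∧ ∀ p ∈ V, p.1 ≠ x ∧ p.2 ≠ x}

end Core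
section WField

variable {A : Type*} [LinearOrder A] [Fintype A]

/-- Fuel-indexed version of the recursively defined gradient field `W` of the paper,
for the complex `K` restricted to the subset `S`, the cubes taking the fixed value `1`
on `O` (and `0` outside `O ∪ S`).  The three disjuncts are the parts
`W^m`, `V^r` and `Y` of the definition. -/
def Wf (K : Set (Cube A)) : ℕ → Finset A → Finset A →
    Set (List (Finset A) × List (Finset A))
  | 0, _, _ => ∅
  | n + 1, O, S =>
    {p | ∃ hS : S.Nonempty,
      (cubeOn (O ∪ S.erase (S.max' hS)) {S.max' hS} ∈ K ∧
        ∃ q ∈ Wf K n O (S.erase (S.max' hS)),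
          p = (q.1 ++ [({S.max' hS} : Finset A)], q.2 ++ [({S.max' hS} : Finset A)])) ∨
      (∃ (C B D : Finset A) (π ρ : List (Finset A)),
        B.Nonempty ∧ Disjoint C B ∧ Disjoint C D ∧ Disjoint B D ∧
        C ∪ B ∪ D = S.erase (S.max' hS) ∧ IsOPart C π ∧ IsOPart D ρ ∧
        p = (π ++ [({S.max' hS} : Finset A)] ++ [B] ++ ρ,
             π ++ [insert (S.max' hS) B] ++ ρ) ∧
        p.1 ∈ PK K O S ∧ p.2 ∈ PK K O S) ∨
      (∃ C B D : Finset A,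
        B.Nonempty ∧ Disjoint C B ∧ Disjoint C D ∧ Disjoint B D ∧
        C ∪ B ∪ D = S.erase (S.max' hS) ∧
        cubeOn (O ∪ C) (insert (S.max' hS) B) ∉ K ∧
        cubeOn (O ∪ C) {S.max' hS} ∈ K ∧
        cubeOn (O ∪ C ∪ {S.max' hS}) B ∈ K ∧
        ((∃ π ∈ PK K O C, ∃ q ∈ Wf K n (O ∪ (S \ D)) D,
            p = (π ++ [({S.max' hS} : Finset A)] ++ [B] ++ q.1,
                 π ++ [({S.max' hS} : Finset A)] ++ [B] ++ q.2)) ∨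
         (∃ q ∈ Wf K n O C, ∃ ρ ∈ PK K (O ∪ (S \ D)) D,
            (∀ r ∈ Wf K n (O ∪ (S \ D)) D, r.1 ≠ ρ ∧ r.2 ≠ ρ) ∧
            p = (q.1 ++ [({S.max' hS} : Finset A)] ++ [B] ++ ρ,
                 q.2 ++ [({S.max' hS} : Finset A)] ++ [B] ++ ρ))))}

/-- The gradient field `W_K` of the paper, on the poset `P` of ordered partitions of `S`
belonging to the restricted complex (fixed value `1` on `O`, `0` outside `O ∪ S`). -/
def WK (K : Set (Cube A)) (O S : Finset A) :
    Set (List (Finset A) × List (Finset A)) :=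
  Wf K S.card O S

end WField

section OrderedPartitions

theorem pdim_append {A : Type*} (L M : List (Finset A)) : pdim (L ++ M) = pdim L + pdim M := by
  simp [pdim]

theorem pdim_cons {A : Type*} (B : Finset A) (L : List (Finset A)) :
    pdim (B :: L) = (B.card - 1) + pdim L := by
  simp [pdim]

variable {A : Type*} [DecidableEq A]

@[simp] theorem blocksUnion_nil : blocksUnion ([] : List (Finset A)) = ∅ := rfl

@[simp] theorem blocksUnion_cons (B : Finset A) (L : List (Finset A)) :
    blocksUnion (B :: L) = B ∪ blocksUnion L := rfl

@[simp] theorem blocksUnion_append (L M : List (Finset A)) :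
    blocksUnion (L ++ M) = blocksUnion L ∪ blocksUnion M := by
  induction L with
  | nil => simp
  | cons B L ih => simp [ih]

theorem disjoint_blocksUnion {X : Finset A} {L : List (Finset A)} :
    Disjoint X (blocksUnion L) ↔ ∀ B ∈ L, Disjoint X B := by
  induction L with
  | nil => simp
  | cons B L ih => simp [ih]

theorem isOPart_nil {S : Finset A} : IsOPart S [] ↔ S = ∅ := by
  simp [IsOPart, eq_comm]

theorem isOPart_cons {S B : Finset A} {L : List (Finset A)} :
    IsOPart S (B :: L) ↔ B.Nonempty ∧ Disjoint B (blocksUnion L) ∧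
      IsOPart (blocksUnion L) L ∧ B ∪ blocksUnion L = S := by
  simp only [IsOPart, List.mem_cons, forall_eq_or_imp, List.pairwise_cons, blocksUnion_cons,
    disjoint_blocksUnion]
  tauto

theorem isOPart_append {S : Finset A} {L M : List (Finset A)} :
    IsOPart S (L ++ M) ↔ Disjoint (blocksUnion L) (blocksUnion M) ∧
      IsOPart (blocksUnion L) L ∧ IsOPart (blocksUnion M) M ∧
        blocksUnion L ∪ blocksUnion M = S := by
  induction L generalizing S with
  | nil =>
    simp only [List.nil_append, blocksUnion_nil, Finset.disjoint_empty_left, isOPart_nil,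
      Finset.empty_union, true_and]
    exact ⟨fun h => ⟨by rwa [h.2.2], h.2.2⟩, fun h => h.2 ▸ h.1⟩
  | cons B L ih =>
    simp only [List.cons_append, isOPart_cons, ih, blocksUnion_append, blocksUnion_cons,
      Finset.disjoint_union_left, Finset.disjoint_union_right, Finset.union_assoc]
    tauto

theorem IsOPart.blocksUnion_eq {S : Finset A} {L : List (Finset A)} (h : IsOPart S L) :
    blocksUnion L = S := h.2.2

/-- The position of the block containing a given point is determined by the ordered partition. -/
theorem append_cons_inj_of_mem {m : A} {u u' v v' : List (Finset A)} {Z Z' : Finset A}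
    (hZ : m ∈ Z) (hZ' : m ∈ Z') (hu : m ∉ blocksUnion u) (hu' : m ∉ blocksUnion u')
    (h : u ++ Z :: v = u' ++ Z' :: v') : u = u' ∧ Z = Z' ∧ v = v' := by
  induction u generalizing u' with
  | nil =>
    cases u' with
    | nil => simpa using h
    | cons X u' =>
      simp only [List.nil_append, List.cons_append, List.cons.injEq] at h
      simp [← h.1, hZ] at hu'
  | cons Y u ih =>
    cases u' with
    | nil =>
      simp only [List.nil_append, List.cons_append, List.cons.injEq] at h
      simp [h.1, hZ'] at hu
    | cons X u' =>
      simp only [List.cons_append, List.cons.injEq, blocksUnion_cons, Finset.mem_union,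
        not_or] at h hu hu'
      obtain ⟨h1, h2, h3⟩ := ih hu.2 hu'.2 h.2
      exact ⟨by rw [h.1, h1], h2, h3⟩

/-- `x` is obtained from `y` by splitting one block into two consecutive blocks. -/
def IsSplit (x y : List (Finset A)) : Prop :=
  ∃ l E F r, E.Nonempty ∧ F.Nonempty ∧ Disjoint E F ∧
    x = l ++ E :: F :: r ∧ y = l ++ (E ∪ F) :: r

theorem IsSplit.length_eq {x y : List (Finset A)} (h : IsSplit x y) :
    x.length = y.length + 1 := by
  obtain ⟨l, E, F, r, -, -, -, rfl, rfl⟩ := h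
  simp; omega

theorem IsSplit.blocksUnion_eq {x y : List (Finset A)} (h : IsSplit x y) :
    blocksUnion x = blocksUnion y := by
  obtain ⟨l, E, F, r, -, -, -, rfl, rfl⟩ := h
  simp

/-- A splitting of `u | Z | v` splits `u`, the block `Z`, or `v`. -/
theorem isSplit_append_cons {x u v : List (Finset A)} {Z : Finset A}
    (h : IsSplit x (u ++ Z :: v)) :
    (∃ u', IsSplit u' u ∧ x = u' ++ Z :: v) ∨
    (∃ E F, E.Nonempty ∧ F.Nonempty ∧ Disjoint E F ∧ E ∪ F = Z ∧ x = u ++ E :: F :: v) ∨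
    (∃ v', IsSplit v' v ∧ x = u ++ Z :: v') := by
  obtain ⟨l, E, F, r, hE, hF, hd, rfl, h⟩ := h
  rcases List.append_eq_append_iff.1 h with ⟨c, rfl, hc⟩ | ⟨c, rfl, hc⟩
  · cases c with
    | nil =>
      simp only [List.nil_append, List.cons.injEq] at hc
      exact Or.inr (Or.inl ⟨E, F, hE, hF, hd, hc.1.symm, by simp [hc.2]⟩)
    | cons X c =>
      simp only [List.cons_append, List.cons.injEq] at hc
      obtain ⟨rfl, rfl⟩ := hc
      exact Or.inr (Or.inr ⟨_, ⟨c, E, F, r, hE, hF, hd, rfl, rfl⟩, by simp⟩)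
  · cases c with
    | nil =>
      simp only [List.nil_append, List.cons.injEq] at hc
      exact Or.inr (Or.inl ⟨E, F, hE, hF, hd, hc.1, by simp [hc.2]⟩)
    | cons X c =>
      simp only [List.cons_append, List.cons.injEq] at hc
      obtain ⟨rfl, rfl⟩ := hc
      exact Or.inl ⟨_, ⟨l, E, F, c, hE, hF, hd, rfl, rfl⟩, by simp⟩

theorem union_ne_singleton {m : A} {E F : Finset A} (hE : E.Nonempty)
    (hF : F.Nonempty) (hd : Disjoint E F) : E ∪ F ≠ {m} := by
  intro h
  have h1 := Finset.card_union_of_disjoint hd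
  rw [h, Finset.card_singleton] at h1
  have := hE.card_pos
  have := hF.card_pos
  omega

theorem card_blocksUnion {S : Finset A} {L : List (Finset A)} (h : IsOPart S L) :
    (blocksUnion L).card = pdim L + L.length := by
  induction L generalizing S with
  | nil => simp [pdim]
  | cons B L ih =>
    obtain ⟨hB, hd, hL, -⟩ := isOPart_cons.1 h
    rw [blocksUnion_cons, Finset.card_union_of_disjoint hd, ih hL, pdim_cons, List.length_cons]
    have := hB.card_pos
    omega

/-- Uniting consecutive blocks does not lower the dimension; it preserves it only if nothing is
united, and raises it by one only if a single pair of blocks is united. -/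
theorem pdim_flatten_le {S : Finset A} {LL : List (List (Finset A))} (hne : ∀ l ∈ LL, l ≠ [])
    (h : IsOPart S LL.flatten) :
    pdim LL.flatten ≤ pdim (LL.map blocksUnion) ∧
      (pdim (LL.map blocksUnion) = pdim LL.flatten → LL.map blocksUnion = LL.flatten) ∧
      (pdim (LL.map blocksUnion) = pdim LL.flatten + 1 →
        IsSplit LL.flatten (LL.map blocksUnion)) := by
  induction LL generalizing S with
  | nil => simp [pdim]
  | cons l LL ih =>
    rw [List.flatten_cons] at h
    obtain ⟨-, hl, hLL, -⟩ := isOPart_append.1 h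
    obtain ⟨i1, i2, i3⟩ := ih (fun l hl => hne l (List.mem_cons_of_mem _ hl)) hLL
    have hc := card_blocksUnion hl
    have hlen := List.length_pos_of_ne_nil (hne l List.mem_cons_self)
    simp only [List.flatten_cons, List.map_cons, pdim_cons, pdim_append]
    have single : l.length = 1 → l = [blocksUnion l] := by
      intro h1
      obtain ⟨B, rfl⟩ := List.length_eq_one_iff.1 h1
      simp
    refine ⟨by omega, fun h1 => ?_, fun h1 => ?_⟩
    · rw [i2 (by omega)]
      conv_rhs => rw [single (by omega)]
      simp
    · rcases (show l.length = 1 ∨ l.length = 2 by omega) with h2 | h2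
      · obtain ⟨p, E, F, r, hE, hF, hd, e1, e2⟩ := i3 (by omega)
        refine ⟨blocksUnion l :: p, E, F, r, hE, hF, hd, ?_, by simp [e2]⟩
        conv_lhs => rw [single h2, e1]
        simp
      · obtain ⟨E, F, rfl⟩ := List.length_eq_two.1 h2
        rw [isOPart_cons, isOPart_cons] at hl
        exact ⟨[], E, F, LL.flatten, hl.1, hl.2.2.1.1, by simpa using hl.2.1, by simp,
          by simp [i2 (by omega)]⟩

theorem PFacet.isSplit {S : Finset A} {x y : List (Finset A)} (h : PFacet x y)
    (hx : IsOPart S x) : IsSplit x y := by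
  obtain ⟨⟨LL, hne, rfl, rfl⟩, -, hp⟩ := h
  exact (pdim_flatten_le hne hx).2.2 hp

/-- `VStep V y x`: a gradient path of `V` may go from `x` to `y` in one step. -/
def VStep (V : Set (List (Finset A) × List (Finset A))) (y x : List (Finset A)) : Prop :=
  ∃ b, (x, b) ∈ V ∧ (y, b) ∉ V ∧ IsSplit y b

theorem acc_of_not_lower {V : Set (List (Finset A) × List (Finset A))} {x : List (Finset A)}
    (h : ∀ b, (x, b) ∉ V) : Acc (VStep V) x :=
  ⟨_, fun _ ⟨b, hb, _⟩ => (h b hb).elim⟩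

theorem pGradient_of_wellFounded {V : Set (List (Finset A) × List (Finset A))} {S : Finset A}
    (hV : ∀ p ∈ V, IsOPart S p.1) (hwf : WellFounded (VStep V)) : PGradient V := by
  rintro k a b ⟨hk, h0, h⟩
  obtain ⟨k, rfl⟩ := Nat.exists_eq_succ_of_ne_zero hk.ne'
  have hpart : ∀ i, IsOPart S (a i) := by
    intro i
    refine Fin.lastCases ?_ (fun i => hV _ (h i).1) i
    rw [← h0]
    exact hV _ (h 0).1
  have hstep : ∀ i : Fin (k + 1), VStep V (a i.succ) (a i.castSucc) := fun i =>
    ⟨b i, (h i).1, (h i).2.1, (h i).2.2.isSplit (hpart _)⟩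
  obtain ⟨_, ⟨i, rfl⟩, hi⟩ := hwf.has_min (Set.range a) ⟨_, 0, rfl⟩
  induction i using Fin.lastCases with
  | last =>
    rw [← h0] at hi
    exact hi _ ⟨_, rfl⟩ (hstep 0)
  | cast i => exact hi _ ⟨_, rfl⟩ (hstep i)

end OrderedPartitions

section Acyclicity

variable {A : Type*} [LinearOrder A] {K : Set (Cube A)} {n : ℕ} {O S : Finset A}

/-- The condition that `(C, B, D)` is a branching sequence. -/
def IsBranching (K : Set (Cube A)) (O S : Finset A) (m : A) (C B D : Finset A) : Prop :=
  B.Nonempty ∧ Disjoint C B ∧ Disjoint C D ∧ Disjoint B D ∧ C ∪ B ∪ D = S.erase m ∧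
    cubeOn (O ∪ C) (insert m B) ∉ K ∧ cubeOn (O ∪ C) {m} ∈ K ∧ cubeOn (O ∪ C ∪ {m}) B ∈ K

theorem mem_Wf_succ {p : List (Finset A) × List (Finset A)} :
    p ∈ Wf K (n + 1) O S ↔ ∃ hS : S.Nonempty,
      (cubeOn (O ∪ S.erase (S.max' hS)) {S.max' hS} ∈ K ∧
        ∃ x y, (x, y) ∈ Wf K n O (S.erase (S.max' hS)) ∧
          p = (x ++ [{S.max' hS}], y ++ [{S.max' hS}])) ∨
      (∃ (C B D : Finset A) (π ρ : List (Finset A)),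
        B.Nonempty ∧ Disjoint C B ∧ Disjoint C D ∧ Disjoint B D ∧
        C ∪ B ∪ D = S.erase (S.max' hS) ∧ IsOPart C π ∧ IsOPart D ρ ∧
        p = (π ++ {S.max' hS} :: B :: ρ, π ++ insert (S.max' hS) B :: ρ) ∧
        p.1 ∈ PK K O S ∧ p.2 ∈ PK K O S) ∨
      (∃ C B D : Finset A, IsBranching K O S (S.max' hS) C B D ∧
        ((∃ π ∈ PK K O C, ∃ x y, (x, y) ∈ Wf K n (O ∪ (S \ D)) D ∧
            p = (π ++ {S.max' hS} :: B :: x, π ++ {S.max' hS} :: B :: y)) ∨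
         (∃ x y, (x, y) ∈ Wf K n O C ∧ ∃ ρ ∈ PK K (O ∪ (S \ D)) D,
            (∀ r ∈ Wf K n (O ∪ (S \ D)) D, r.1 ≠ ρ ∧ r.2 ≠ ρ) ∧
            p = (x ++ {S.max' hS} :: B :: ρ, y ++ {S.max' hS} :: B :: ρ)))) := by
  simp only [Wf, Set.mem_ofPred_eq, List.append_assoc, List.cons_append, List.nil_append,
    IsBranching, Prod.exists, and_assoc]

theorem isOPart_append_singleton {S : Finset A} {m : A} {x : List (Finset A)} (hm : m ∈ S)
    (h : IsOPart (S.erase m) x) : IsOPart S (x ++ [{m}]) := by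
  rw [isOPart_append, h.blocksUnion_eq]
  simp [isOPart_cons, isOPart_nil, h, hm, Finset.union_comm _ {m}]

theorem isOPart_append_cons_cons {S C B D : Finset A} {m : A} {x y : List (Finset A)} (hm : m ∈ S)
    (hB : B.Nonempty) (h1 : Disjoint C B) (h2 : Disjoint C D) (h3 : Disjoint B D)
    (h : C ∪ B ∪ D = S.erase m) (hx : IsOPart C x) (hy : IsOPart D y) :
    IsOPart S (x ++ {m} :: B :: y) := by
  have hmem : m ∉ C ∪ B ∪ D := by simp [h]
  simp only [Finset.mem_union, not_or] at hmem
  have hS : S = insert m (C ∪ B ∪ D) := by rw [h, Finset.insert_erase hm]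
  rw [isOPart_append, hx.blocksUnion_eq]
  simp only [isOPart_cons, blocksUnion_cons, hy.blocksUnion_eq]
  refine ⟨?_, hx, ⟨by simp, ?_, ⟨hB, h3, hy, trivial⟩, trivial⟩, ?_⟩
  · simp [h1, h2, hmem]
  · simp [hmem]
  · rw [hS]; ext a; simp

theorem isOPart_of_mem_Wf {p : List (Finset A) × List (Finset A)} (hp : p ∈ Wf K n O S) :
    IsOPart S p.1 ∧ IsOPart S p.2 := by
  induction n generalizing O S p with
  | zero => simp [Wf] at hp
  | succ n ih =>
    obtain ⟨hS, ⟨-, x, y, hq, rfl⟩ | ⟨C, B, D, π, ρ, -, -, -, -, -, -, -, -, h1, h2⟩ |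
      ⟨C, B, D, ⟨hB, hCB, hCD, hBD, hu, -⟩, h⟩⟩ := mem_Wf_succ.1 hp
    · exact ⟨isOPart_append_singleton (S.max'_mem hS) (ih hq).1,
        isOPart_append_singleton (S.max'_mem hS) (ih hq).2⟩
    · exact ⟨h1.1, h2.1⟩
    · rcases h with ⟨π, hπ, x, y, hq, rfl⟩ | ⟨x, y, hq, ρ, hρ, -, rfl⟩
      · exact ⟨isOPart_append_cons_cons (S.max'_mem hS) hB hCB hCD hBD hu hπ.1 (ih hq).1,
          isOPart_append_cons_cons (S.max'_mem hS) hB hCB hCD hBD hu hπ.1 (ih hq).2⟩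
      · exact ⟨isOPart_append_cons_cons (S.max'_mem hS) hB hCB hCD hBD hu (ih hq).1 hρ.1,
          isOPart_append_cons_cons (S.max'_mem hS) hB hCB hCD hBD hu (ih hq).2 hρ.1⟩

theorem length_of_mem_Wf {p : List (Finset A) × List (Finset A)} (hp : p ∈ Wf K n O S) :
    p.1.length = p.2.length + 1 := by
  induction n generalizing O S p with
  | zero => simp [Wf] at hp
  | succ n ih =>
    obtain ⟨hS, ⟨-, x, y, hq, rfl⟩ | ⟨C, B, D, π, ρ, -, -, -, -, -, -, -, rfl, -, -⟩ |
      ⟨C, B, D, -, ⟨π, -, x, y, hq, rfl⟩ | ⟨x, y, hq, ρ, -, -, rfl⟩⟩⟩ := mem_Wf_succ.1 hp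
    · have := ih hq
      simp at this ⊢; omega
    · simp; omega
    · have := ih hq
      simp at this ⊢; omega
    · have := ih hq
      simp at this ⊢; omega

theorem notMem_of_isOPart_append {S Z : Finset A} {m : A} {x y : List (Finset A)}
    (h : IsOPart S (x ++ Z :: y)) (hm : m ∈ Z) : m ∉ blocksUnion x := fun hx =>
  Finset.disjoint_left.1 (isOPart_append.1 h).1 hx (by simp [hm])

theorem eq_singleton_of_lower {x y u v : List (Finset A)} {Z : Finset A} (hS : S.Nonempty)
    (h : (x, y) ∈ Wf K (n + 1) O S) (hx : x = u ++ Z :: v) (hZ : S.max' hS ∈ Z) :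
    Z = {S.max' hS} := by
  have hp := (isOPart_of_mem_Wf h).1
  have key : ∃ s t, x = s ++ {S.max' hS} :: t := by
    obtain ⟨hS, ⟨-, x', y', hq, he⟩ | ⟨C, B, D, π, ρ, -, -, -, -, -, -, -, he, -, -⟩ |
      ⟨C, B, D, -, ⟨π, -, x', y', hq, he⟩ | ⟨x', y', hq, ρ, -, -, he⟩⟩⟩ := mem_Wf_succ.1 h
    all_goals exact ⟨_, _, (Prod.ext_iff.1 he).1⟩
  obtain ⟨s, t, rfl⟩ := key
  have h2 := notMem_of_isOPart_append hp (Finset.mem_singleton_self _)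
  rw [hx] at hp
  exact (append_cons_inj_of_mem hZ (Finset.mem_singleton_self _)
    (notMem_of_isOPart_append hp hZ) h2 hx.symm).2.1

/-- The pairs whose lower cell is `x | m`. -/
theorem mem_Wf_append_singleton {x b : List (Finset A)} (hS : S.Nonempty)
    (h : (x ++ [{S.max' hS}], b) ∈ Wf K (n + 1) O S) :
    cubeOn (O ∪ S.erase (S.max' hS)) {S.max' hS} ∈ K ∧
      ∃ y, (x, y) ∈ Wf K n O (S.erase (S.max' hS)) ∧ b = y ++ [{S.max' hS}] := by
  have hp := (isOPart_of_mem_Wf h).1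
  have hm := Finset.mem_singleton_self (S.max' hS)
  have key : ∀ u Z v, x ++ [{S.max' hS}] ≠ u ++ {S.max' hS} :: Z :: v := by
    intro u Z v he
    have h1 := notMem_of_isOPart_append hp hm
    rw [he] at hp
    have h2 := notMem_of_isOPart_append hp hm
    simpa using (append_cons_inj_of_mem hm hm h1 h2 he).2.2
  obtain ⟨_, ⟨hK, x', y', hq, he⟩ | ⟨C, B, D, π, ρ, -, -, -, -, -, -, -, he, -, -⟩ |
      ⟨C, B, D, -, ⟨π, -, x', y', hq, he⟩ | ⟨x', y', hq, ρ, -, -, he⟩⟩⟩ := mem_Wf_succ.1 h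
  · obtain ⟨h1, rfl⟩ := Prod.ext_iff.1 he
    obtain rfl : x = x' := by simpa using h1
    exact ⟨hK, y', hq, rfl⟩
  all_goals exact (key _ _ _ (Prod.ext_iff.1 he).1).elim

/-- The pairs whose lower cell is `π | m | B | ρ`. -/
theorem mem_Wf_append_cons_cons {π ρ b : List (Finset A)} {B : Finset A} (hS : S.Nonempty)
    (h : (π ++ {S.max' hS} :: B :: ρ, b) ∈ Wf K (n + 1) O S) :
    (cubeOn (O ∪ blocksUnion π) (insert (S.max' hS) B) ∈ K ∧
      b = π ++ insert (S.max' hS) B :: ρ) ∨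
    (IsBranching K O S (S.max' hS) (blocksUnion π) B (blocksUnion ρ) ∧
      ((π ∈ PK K O (blocksUnion π) ∧
        ∃ y, (ρ, y) ∈ Wf K n (O ∪ (S \ blocksUnion ρ)) (blocksUnion ρ) ∧
          b = π ++ {S.max' hS} :: B :: y) ∨
       (ρ ∈ PK K (O ∪ (S \ blocksUnion ρ)) (blocksUnion ρ) ∧
        (∀ r ∈ Wf K n (O ∪ (S \ blocksUnion ρ)) (blocksUnion ρ), r.1 ≠ ρ ∧ r.2 ≠ ρ) ∧
        ∃ y, (π, y) ∈ Wf K n O (blocksUnion π) ∧ b = y ++ {S.max' hS} :: B :: ρ))) := by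
  have hp := (isOPart_of_mem_Wf h).1
  have hm := Finset.mem_singleton_self (S.max' hS)
  have key : ∀ u v, π ++ {S.max' hS} :: B :: ρ = u ++ {S.max' hS} :: v →
      u = π ∧ v = B :: ρ := by
    intro u v he
    have h1 := notMem_of_isOPart_append hp hm
    rw [he] at hp
    have h2 := notMem_of_isOPart_append hp hm
    have := append_cons_inj_of_mem hm hm h1 h2 he
    exact ⟨this.1.symm, this.2.2.symm⟩
  obtain ⟨_, ⟨hK, x', y', hq, he⟩ | ⟨C, B, D, π, ρ, -, -, -, -, -, hC, hD, he, -, hK⟩ |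
      ⟨C, B, D, hbr, ⟨π, hπ, x', y', hq, he⟩ | ⟨x', y', hq, ρ, hρ, hcr, he⟩⟩⟩ := mem_Wf_succ.1 h
  · simpa using (key _ _ (Prod.ext_iff.1 he).1).2
  · obtain ⟨h1, rfl⟩ := Prod.ext_iff.1 he
    obtain ⟨rfl, h2⟩ := key _ _ h1
    obtain ⟨rfl, rfl⟩ := List.cons.inj h2
    refine Or.inl ⟨?_, rfl⟩
    have := hK.2 π.length (by simp)
    simpa using this
  · obtain ⟨h1, rfl⟩ := Prod.ext_iff.1 he
    obtain ⟨rfl, h2⟩ := key _ _ h1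
    obtain ⟨rfl, rfl⟩ := List.cons.inj h2
    obtain rfl := hπ.1.blocksUnion_eq
    obtain rfl := (isOPart_of_mem_Wf hq).1.blocksUnion_eq
    exact Or.inr ⟨hbr, Or.inl ⟨hπ, y', hq, rfl⟩⟩
  · obtain ⟨h1, rfl⟩ := Prod.ext_iff.1 he
    obtain ⟨rfl, h2⟩ := key _ _ h1
    obtain ⟨rfl, rfl⟩ := List.cons.inj h2
    obtain rfl := hρ.1.blocksUnion_eq
    obtain rfl := (isOPart_of_mem_Wf hq).1.blocksUnion_eq
    exact Or.inr ⟨hbr, Or.inr ⟨hρ, hcr, y', hq, rfl⟩⟩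

/-- No cell is both the upper cell of a pair and the lower cell of a pair. -/
theorem upper_ne_lower {x y z : List (Finset A)} (h : (x, y) ∈ Wf K n O S) :
    (y, z) ∉ Wf K n O S := by
  induction n generalizing O S x y z with
  | zero => simp [Wf] at h
  | succ n ih =>
    intro h'
    obtain ⟨hS, ⟨hK, x', y', hq, he⟩ | ⟨C, B, D, π, ρ, hB, -, -, -, hu, -, -, he, -, -⟩ |
      ⟨C, B, D, hbr, ⟨π, hπ, x', y', hq, he⟩ | ⟨x', y', hq, ρ, hρ, hcr, he⟩⟩⟩ := mem_Wf_succ.1 h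
    · obtain ⟨rfl, rfl⟩ := Prod.ext_iff.1 he
      obtain ⟨-, _, h1, -⟩ := mem_Wf_append_singleton hS h'
      exact ih hq h1
    · obtain ⟨rfl, rfl⟩ := Prod.ext_iff.1 he
      have h1 := eq_singleton_of_lower hS h' rfl (Finset.mem_insert_self _ _)
      obtain ⟨c, hc⟩ := hB
      have h2 : c ∈ S.erase (S.max' hS) := by simp [← hu, hc]
      have h3 : c ∈ ({S.max' hS} : Finset A) := h1 ▸ Finset.mem_insert_of_mem hc
      simp_all
    · obtain ⟨rfl, rfl⟩ := Prod.ext_iff.1 he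
      obtain rfl := hπ.1.blocksUnion_eq
      obtain rfl := (isOPart_of_mem_Wf hq).2.blocksUnion_eq
      rcases mem_Wf_append_cons_cons hS h' with ⟨h1, -⟩ |
        ⟨-, ⟨-, _, h1, -⟩ | ⟨-, h1, -⟩⟩
      · exact hbr.2.2.2.2.2.1 h1
      · exact ih hq h1
      · exact (h1 _ hq).2 rfl
    · obtain ⟨rfl, rfl⟩ := Prod.ext_iff.1 he
      obtain rfl := hρ.1.blocksUnion_eq
      obtain rfl := (isOPart_of_mem_Wf hq).2.blocksUnion_eq
      rcases mem_Wf_append_cons_cons hS h' with ⟨h1, -⟩ |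
        ⟨-, ⟨-, _, h1, -⟩ | ⟨-, -, _, h1, -⟩⟩
      · exact hbr.2.2.2.2.2.1 h1
      · exact (hcr _ h1).1 rfl
      · exact ih hq h1

theorem acc_append_singleton {x : List (Finset A)} (hS : S.Nonempty)
    (hx : Acc (VStep (Wf K n O (S.erase (S.max' hS)))) x) :
    Acc (VStep (Wf K (n + 1) O S)) (x ++ [{S.max' hS}]) := by
  induction hx with
  | intro x _ ih =>
    refine ⟨_, ?_⟩
    rintro y ⟨b, hb, hyb, hs⟩
    obtain ⟨hK, z, hz, rfl⟩ := mem_Wf_append_singleton hS hb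
    rcases isSplit_append_cons hs with ⟨u, hu, rfl⟩ | ⟨E, F, hE, hF, hd, he, -⟩ | ⟨v, hv, -⟩
    · refine ih u ⟨z, hz, fun hc => hyb ?_, hu⟩
      exact mem_Wf_succ.2 ⟨hS, Or.inl ⟨hK, u, z, hc, rfl⟩⟩
    · exact (union_ne_singleton hE hF hd he).elim
    · obtain ⟨l, E, F, r, -, -, -, -, h⟩ := hv
      simp at h

/-- A step through the upper cell `π | B ∪ m | ρ` leads to an accessible cell. -/
theorem acc_of_merge_step {π ρ y : List (Finset A)} {B : Finset A} (hS : S.Nonempty)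
    (hwf : WellFounded (VStep (Wf K n O (S.erase (S.max' hS)))))
    (hx : (π ++ {S.max' hS} :: B :: ρ, π ++ insert (S.max' hS) B :: ρ) ∈ Wf K (n + 1) O S)
    (ih : ∀ B' ρ', Acc (VStep (Wf K (n + 1) O S)) ((π ++ [B]) ++ {S.max' hS} :: B' :: ρ'))
    (hy : (y, π ++ insert (S.max' hS) B :: ρ) ∉ Wf K (n + 1) O S)
    (hs : IsSplit y (π ++ insert (S.max' hS) B :: ρ)) :
    Acc (VStep (Wf K (n + 1) O S)) y := by
  by_cases hyl : ∃ b, (y, b) ∈ Wf K (n + 1) O S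
  swap
  · exact acc_of_not_lower fun b hb => hyl ⟨b, hb⟩
  obtain ⟨b, hb⟩ := hyl
  have hp := (isOPart_of_mem_Wf hx).1
  rw [isOPart_append, isOPart_cons, isOPart_cons] at hp
  obtain ⟨-, -, ⟨-, hmB, ⟨hB, -⟩, -⟩, -⟩ := hp
  simp only [blocksUnion_cons, Finset.disjoint_singleton_left, Finset.mem_union, not_or] at hmB
  have hmem := Finset.mem_insert_self (S.max' hS) B
  have hne : insert (S.max' hS) B ≠ {S.max' hS} := by
    intro h
    obtain ⟨c, hc⟩ := hB
    have : c ∈ ({S.max' hS} : Finset A) := h ▸ Finset.mem_insert_of_mem hc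
    rw [Finset.mem_singleton] at this
    exact hmB.1 (this ▸ hc)
  rcases isSplit_append_cons hs with ⟨u, -, rfl⟩ | ⟨E, F, hE, hF, hd, he, rfl⟩ | ⟨v, -, rfl⟩
  · exact (hne (eq_singleton_of_lower hS hb rfl hmem)).elim
  · have erase_eq : (insert (S.max' hS) B).erase (S.max' hS) = B :=
      Finset.erase_insert hmB.1
    rw [← he, Finset.mem_union] at hmem
    rcases hmem with hm | hm
    · obtain rfl := eq_singleton_of_lower hS hb rfl hm
      rw [Finset.disjoint_singleton_left] at hd
      have : F = B := by rw [← erase_eq, ← he]; ext; grind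
      exact (hy (this ▸ hx)).elim
    · obtain rfl := eq_singleton_of_lower (u := π ++ [E]) (v := ρ) hS hb (by simp) hm
      rw [Finset.disjoint_singleton_right] at hd
      obtain rfl : E = B := by rw [← erase_eq, ← he]; ext; grind
      cases ρ with
      | nil => simpa using acc_append_singleton (x := π ++ [E]) hS (hwf.apply _)
      | cons B' ρ' => simpa using ih B' ρ'
  · exact (hne (eq_singleton_of_lower hS hb rfl hmem)).elim

/-- Accessibility of the cells `π | m | B | ρ`, where `π` and `ρ` are ordered partitions of fixed
sets `C` and `D`, given accessibility of the cells with larger `C` or smaller `B`. -/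
theorem acc_of_blocksUnion_eq (hS : S.Nonempty)
    (hwf : ∀ O S : Finset A, WellFounded (VStep (Wf K n O S))) (C B D : Finset A)
    (ihC : ∀ π ρ, (π ++ {S.max' hS} :: B :: ρ, π ++ insert (S.max' hS) B :: ρ) ∈
      Wf K (n + 1) O S → blocksUnion π = C → ∀ B' ρ',
        Acc (VStep (Wf K (n + 1) O S)) ((π ++ [B]) ++ {S.max' hS} :: B' :: ρ'))
    (ihB : ∀ B' π ρ, B'.card < B.card → blocksUnion π = C →
      Acc (VStep (Wf K (n + 1) O S)) (π ++ {S.max' hS} :: B' :: ρ))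
    (N : ℕ) (π ρ : List (Finset A)) (hN : π.length = N) (hC : blocksUnion π = C)
    (hD : blocksUnion ρ = D) :
    Acc (VStep (Wf K (n + 1) O S)) (π ++ {S.max' hS} :: B :: ρ) := by
  induction N using Nat.strong_induction_on generalizing π ρ with
  | _ N ihN =>
  induction ρ using (hwf (O ∪ (S \ D)) D).induction generalizing π with
  | _ ρ ihρ =>
  induction π using (hwf O C).induction with
  | _ π ihπ =>
  refine ⟨_, ?_⟩
  rintro y ⟨b, hb, hyb, hs⟩
  have split_B : ∀ π' E F ρ', blocksUnion π' = C → E.Nonempty → F.Nonempty → Disjoint E F →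
      E ∪ F = B → Acc (VStep (Wf K (n + 1) O S)) (π' ++ {S.max' hS} :: E :: F :: ρ') := by
    intro π' E F ρ' hC' hE hF hd he
    refine ihB _ _ _ ?_ hC'
    rw [← he, Finset.card_union_of_disjoint hd]
    have := hF.card_pos
    omega
  rcases mem_Wf_append_cons_cons hS hb with ⟨-, rfl⟩ | ⟨hbr, h⟩
  · exact acc_of_merge_step hS (hwf _ _) hb (ihC π ρ hb hC) hyb hs
  rw [hC, hD] at hbr h
  have lower : ∀ π' ρ', blocksUnion π' = C → blocksUnion ρ' = D →
      (∀ z, (ρ', z) ∉ Wf K n (O ∪ (S \ D)) D) →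
      (∃ r ∈ Wf K n (O ∪ (S \ D)) D, r.1 = ρ' ∨ r.2 = ρ') →
      Acc (VStep (Wf K (n + 1) O S)) (π' ++ {S.max' hS} :: B :: ρ') := by
    rintro π' ρ' hC' hD' h1 ⟨r, hr, h2⟩
    refine acc_of_not_lower fun z hz => ?_
    rcases mem_Wf_append_cons_cons hS hz with ⟨h3, -⟩ | ⟨-, h3⟩
    · rw [hC'] at h3
      exact hbr.2.2.2.2.2.1 h3
    · rw [hC', hD'] at h3
      rcases h3 with ⟨-, z, h3, -⟩ | ⟨-, h3, -⟩
      · exact h1 _ h3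
      · have := h3 r hr
        tauto
  rcases h with ⟨hπ, z, hz, rfl⟩ | ⟨hρ, hcr, z, hz, rfl⟩
  · have hzD : blocksUnion z = D := (isOPart_of_mem_Wf hz).2.blocksUnion_eq
    rcases isSplit_append_cons hs with ⟨u, hu, rfl⟩ | ⟨E, F, hE, hF, hd, he, -⟩ | ⟨v, hv, rfl⟩
    · exact lower u z (hu.blocksUnion_eq.trans hC) hzD (fun _ => upper_ne_lower hz)
        ⟨_, hz, Or.inr rfl⟩
    · exact (union_ne_singleton hE hF hd he).elim
    · rcases isSplit_append_cons (u := []) hv with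
        ⟨u, ⟨l, _, _, _, _, _, _, _, h⟩, -⟩ | ⟨E, F, hE, hF, hd, he, rfl⟩ | ⟨w, hw, rfl⟩
      · simp at h
      · exact split_B π E F z hC hE hF hd he
      · refine ihρ w ⟨z, hz, fun hc => hyb ?_, hw⟩ π hN hC (hw.blocksUnion_eq.trans hzD)
        exact mem_Wf_succ.2 ⟨hS, Or.inr (Or.inr ⟨C, B, D, hbr, Or.inl ⟨π, hπ, w, z, hc, rfl⟩⟩)⟩
  · have hzC : blocksUnion z = C := (isOPart_of_mem_Wf hz).2.blocksUnion_eq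
    have hlen := length_of_mem_Wf hz
    rcases isSplit_append_cons hs with ⟨u, hu, rfl⟩ | ⟨E, F, hE, hF, hd, he, -⟩ | ⟨v, hv, rfl⟩
    · have hul := hu.length_eq
      refine ihπ u ⟨z, hz, fun hc => hyb ?_, hu⟩ (by simp at hlen; omega)
        (hu.blocksUnion_eq.trans hzC)
      exact mem_Wf_succ.2 ⟨hS, Or.inr (Or.inr
        ⟨C, B, D, hbr, Or.inr ⟨u, z, hc, ρ, hρ, hcr, rfl⟩⟩)⟩
    · exact (union_ne_singleton hE hF hd he).elim
    · rcases isSplit_append_cons (u := []) hv with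
        ⟨u, ⟨l, _, _, _, _, _, _, _, h⟩, -⟩ | ⟨E, F, hE, hF, hd, he, rfl⟩ | ⟨w, hw, rfl⟩
      · simp at h
      · exact split_B z E F ρ hzC hE hF hd he
      · exact ihN z.length (by simp at hlen; omega) z w rfl hzC (hw.blocksUnion_eq.trans hD)

theorem acc_append_cons_cons (hS : S.Nonempty)
    (hwf : ∀ O S : Finset A, WellFounded (VStep (Wf K n O S))) (π ρ : List (Finset A))
    (B : Finset A) : Acc (VStep (Wf K (n + 1) O S)) (π ++ {S.max' hS} :: B :: ρ) := by
  induction hc : (S \ blocksUnion π).card using Nat.strong_induction_on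
    generalizing π ρ B with
  | _ c ihc =>
  induction hk : B.card using Nat.strong_induction_on generalizing π ρ B with
  | _ k ihk =>
  refine acc_of_blocksUnion_eq hS hwf (blocksUnion π) B (blocksUnion ρ) ?_ ?_ _ π ρ rfl rfl rfl
  · intro π' ρ' h hπ' B' ρ''
    refine ihc _ ?_ (π' ++ [B]) ρ'' B' rfl
    have hp := (isOPart_of_mem_Wf h).1
    rw [isOPart_append, isOPart_cons, isOPart_cons] at hp
    obtain ⟨hd, -, ⟨-, -, ⟨⟨a, ha⟩, -⟩, -⟩, hu⟩ := hp
    rw [← hc, ← hπ']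
    refine Finset.card_lt_card ((Finset.ssubset_iff_of_subset ?_).2 ⟨a, ?_, by simp [ha]⟩)
    · exact Finset.sdiff_subset_sdiff subset_rfl (by simp)
    · rw [Finset.mem_sdiff, ← hu]
      exact ⟨by simp [ha], fun h' => Finset.disjoint_left.1 hd h' (by simp [ha])⟩
  · intro B' π' ρ' hB' hπ'
    exact ihk _ (hk ▸ hB') π' ρ' B' (by rw [hπ', hc]) rfl

theorem wellFounded_vStep_Wf (K : Set (Cube A)) (n : ℕ) (O S : Finset A) :
    WellFounded (VStep (Wf K n O S)) := by
  induction n generalizing O S with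
  | zero => exact ⟨fun x => acc_of_not_lower (by simp [Wf])⟩
  | succ n ih =>
    refine ⟨fun x => ?_⟩
    by_cases hx : ∃ b, (x, b) ∈ Wf K (n + 1) O S
    swap
    · exact acc_of_not_lower fun b hb => hx ⟨b, hb⟩
    obtain ⟨b, hb⟩ := hx
    obtain ⟨hS, ⟨-, x', y', -, he⟩ | ⟨C, B, D, π, ρ, -, -, -, -, -, -, -, he, -, -⟩ |
      ⟨C, B, D, -, ⟨π, -, x', y', -, he⟩ | ⟨x', y', -, ρ, -, -, he⟩⟩⟩ := mem_Wf_succ.1 hb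
    · obtain ⟨rfl, -⟩ := Prod.ext_iff.1 he
      exact acc_append_singleton hS ((ih _ _).apply _)
    all_goals
      obtain ⟨rfl, -⟩ := Prod.ext_iff.1 he
      exact acc_append_cons_cons hS ih _ _ _

end Acyclicity

/-- For every finite linearly ordered set `A` and every `A`-cubical
complex `K`, the discrete vector field `W_K` is a gradient field on the poset `P_K`. -/
theorem stmt_11 {A : Type*} [LinearOrder A] [Fintype A]
    (K : Set (Cube A)) (hK : IsComplex K) :
    PGradient (WK K ∅ Finset.univ) := by
  exact pGradient_of_wellFounded (fun _ hp => (isOPart_of_mem_Wf hp).1)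
    (wellFounded_vStep_Wf K _ _ _)
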